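/- (Symplectic half-flat structures on h₆, giving solutions of the SUSY equations IIA.) For every real t ≠ 0, the 2-form F̂_t = β¹⁴ + 2t·β²⁵ − 2t·β³⁶ is closed, dF̂_t = 0, and the complex 3-form Ψ̂_t = (β¹ + iβ⁴)∧(β² + 2ti·β⁵)∧(−β³ + 2ti·β⁶) satisfies d(Re Ψ̂_t) = 0. Hence (F̂_t, Ψ̂_t) is a symplectic half-flat SU(3) structure on the nilpotent Lie algebra h₆ whose (1,0)-form α̂ = β¹ + iβ⁴ has closed real part. -/

import Mathlib

noncomputable section

/-- `Λ`, the exterior algebra over `ℝ` on six degree-one generators. -/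
abbrev Lam : Type := ExteriorAlgebra ℝ (Fin 6 → ℝ)

/-- The six degree-one generators (indexed from `0`, so `β 0` is the paper's `β¹`
or `e¹`, …, `β 5` is `β⁶` or `e⁶`). -/
def β (i : Fin 6) : Lam := ExteriorAlgebra.ι ℝ (Pi.single i 1)

/-- The real part of the product `(x₁ + i y₁) ∧ (x₂ + i y₂) ∧ (x₃ + i y₃)` of
complex-coefficient forms in `Λ ⊗ ℂ`, expressed in terms of real forms. -/
def reProd3 (x₁ y₁ x₂ y₂ x₃ y₃ : Lam) : Lam :=
  x₁ * x₂ * x₃ - x₁ * y₂ * y₃ - y₁ * x₂ * y₃ - y₁ * y₂ * x₃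

/-- The imaginary part of the product `(x₁ + i y₁) ∧ (x₂ + i y₂) ∧ (x₃ + i y₃)` of
complex-coefficient forms in `Λ ⊗ ℂ`, expressed in terms of real forms. -/
def imProd3 (x₁ y₁ x₂ y₂ x₃ y₃ : Lam) : Lam :=
  x₁ * x₂ * y₃ + x₁ * y₂ * x₃ + y₁ * x₂ * x₃ - y₁ * y₂ * y₃

/-- The graded Leibniz rule: `d (x ∧ y) = dx ∧ y + (-1)^p x ∧ dy` for `p`-forms `x`. -/
def IsLeibniz (d : Lam →ₗ[ℝ] Lam) : Prop :=
  ∀ (p : ℕ) (x y : Lam), x ∈ ⋀[ℝ]^p (Fin 6 → ℝ) →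
    d (x * y) = d x * y + ((-1 : ℝ) ^ p) • (x * d y)

theorem β_mul_self (i : Fin 6) : β i * β i = 0 :=
  ExteriorAlgebra.ι_sq_zero _

theorem β_mul_swap (i j : Fin 6) : β i * β j = -(β j * β i) :=
  eq_neg_of_add_eq_zero_left (ExteriorAlgebra.ι_add_mul_swap _ _)

theorem IsLeibniz.map_β_mul {d : Lam →ₗ[ℝ] Lam} (hd : IsLeibniz d) (i : Fin 6) (y : Lam) :
    d (β i * y) = d (β i) * y - β i * d y := by
  have hi : β i ∈ ⋀[ℝ]^1 (Fin 6 → ℝ) := by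
    rw [ExteriorAlgebra.exteriorPower, pow_one]
    exact LinearMap.mem_range_self _ _
  rw [hd 1 _ y hi, pow_one, neg_one_smul, sub_eq_add_neg]

theorem β_mul_mul_self (i j : Fin 6) : β i * (β j * β i) = 0 := by
  rw [β_mul_swap j i, mul_neg, ← mul_assoc, β_mul_self, zero_mul, neg_zero]

theorem β_mul_self_mul (i : Fin 6) (x : Lam) : β i * (β i * x) = 0 := by
  rw [← mul_assoc, β_mul_self, zero_mul]

theorem β_mul_mul_self_mul (i j : Fin 6) (x : Lam) : β i * (β j * (β i * x)) = 0 := by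
  rw [← mul_assoc (β j), ← mul_assoc, β_mul_mul_self, zero_mul]

/-- Symplectic half-flat structures on `h₆ = (0,0,0,0,12,13)`: for every `t ≠ 0`,
`F̂_t = β¹⁴ + 2t β²⁵ - 2t β³⁶` is closed and
`Ψ̂_t = (β¹ + iβ⁴)(β² + 2ti β⁵)(-β³ + 2ti β⁶)` has closed real part; moreover the
real part `β¹` of the `(1,0)`-form `α̂ = β¹ + iβ⁴` is closed. -/
theorem h6_symplectic_half_flat
    (d : Lam →ₗ[ℝ] Lam) (hleib : IsLeibniz d)
    (h1 : d (β 0) = 0) (h2 : d (β 1) = 0) (h3 : d (β 2) = 0) (h4 : d (β 3) = 0)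
    (h5 : d (β 4) = β 0 * β 1) (h6 : d (β 5) = β 0 * β 2)
    (t : ℝ) (ht : t ≠ 0) :
    d (β 0 * β 3 + (2 * t) • (β 1 * β 4) - (2 * t) • (β 2 * β 5)) = 0 ∧
    d (reProd3 (β 0) (β 3) (β 1) ((2 * t) • β 4) (-(β 2)) ((2 * t) • β 5)) = 0 ∧
    d (β 0) = 0 := by
  have swap : β 1 * (β 0 * β 2) = -(β 0 * (β 1 * β 2)) := by
    rw [← mul_assoc, β_mul_swap 1 0, neg_mul, mul_assoc]
  refine ⟨?_, ?_, h1⟩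
  · simp [hleib.map_β_mul, h1, h2, h3, h4, h5, h6, β_mul_mul_self]
  · simp [reProd3, mul_assoc, mul_sub, hleib.map_β_mul, h1, h2, h3, h4, h5, h6, β_mul_self_mul,
      β_mul_mul_self_mul, swap]
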